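/- L^{10} space-time estimate in ℝ^{3+1}. Let ε > 0 be sufficiently small. There is a constant C such that for every Schwartz function φ on ℝ³ × ℝ, ‖φ‖_{L^{10}_{t,x}(ℝ × ℝ³)} ≤ C ‖∇ φ‖_{X_{0, 1/2+ε}}. -/

import Mathlib

open MeasureTheory Complex Set
open scoped FourierTransform BigOperators RealInnerProductSpace

noncomputable section

abbrev Rn (n : ℕ) := EuclideanSpace ℝ (Fin n)

/-- Japanese bracket of a vector. -/
def jap {n : ℕ} (ξ : Rn n) : ℝ := Real.sqrt (1 + ‖ξ‖ ^ 2)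

/-- Japanese bracket of a real number. -/
def japR (x : ℝ) : ℝ := Real.sqrt (1 + x ^ 2)

/-- Inhomogeneous Sobolev norm ‖⟨ξ⟩^s f̂‖_{L²}. -/
def sobNorm (n : ℕ) (s : ℝ) (f : Rn n → ℂ) : ℝ :=
  (∫ ξ : Rn n, jap ξ ^ (2 * s) * ‖𝓕 f ξ‖ ^ 2) ^ (1/2 : ℝ)

/-- Homogeneous Sobolev norm ‖|ξ|^s f̂‖_{L²}. -/
def sobNormHom (n : ℕ) (s : ℝ) (f : Rn n → ℂ) : ℝ :=
  (∫ ξ : Rn n, ‖ξ‖ ^ (2 * s) * ‖𝓕 f ξ‖ ^ 2) ^ (1/2 : ℝ)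

/-- L^p norm on ℝⁿ. -/
def lpNorm (n : ℕ) (p : ℝ) (f : Rn n → ℂ) : ℝ :=
  (∫ x : Rn n, ‖f x‖ ^ p) ^ (1/p)

/-- Laplacian: sum of second partial derivatives. -/
def laplacian {n : ℕ} (f : Rn n → ℂ) (x : Rn n) : ℂ :=
  ∑ i : Fin n, fderiv ℝ (fun y => fderiv ℝ f y (EuclideanSpace.single i 1)) x
    (EuclideanSpace.single i 1)

/-- Complex gradient as a vector in Euclidean space. -/
def gradC {n : ℕ} (f : Rn n → ℂ) (x : Rn n) : EuclideanSpace ℂ (Fin n) :=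
  (WithLp.equiv 2 (Fin n → ℂ)).symm fun i => fderiv ℝ f x (EuclideanSpace.single i 1)

/-- φ is a solution of the cubic defocussing NLS on ℝⁿ × [0,T] with data φ₀:
smooth, Schwartz in x uniformly for t ∈ [0,T] (with all derivatives),
satisfying i∂ₜφ + Δφ = |φ|²φ and φ(·,0) = φ₀. -/
def IsNLSSolution (n : ℕ) (T : ℝ) (φ : Rn n → ℝ → ℂ) (φ₀ : Rn n → ℂ) : Prop :=
  ContDiff ℝ (⊤ : ℕ∞) (fun p : Rn n × ℝ => φ p.1 p.2) ∧
  (∀ k l : ℕ, ∃ C : ℝ, ∀ t ∈ Icc (0:ℝ) T, ∀ x : Rn n,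
      ‖x‖ ^ k * ‖iteratedFDeriv ℝ l (fun y => φ y t) x‖ ≤ C) ∧
  (∀ x : Rn n, ∀ t ∈ Icc (0:ℝ) T,
      Complex.I * deriv (fun t' => φ x t') t + laplacian (fun y => φ y t) x
        = (‖φ x t‖ : ℂ) ^ 2 * φ x t) ∧
  (∀ x : Rn n, φ x 0 = φ₀ x)

/-- The energy E(f) = ∫ (1/2)|∇f|² + (1/4)|f|⁴. -/
def energy {n : ℕ} (f : Rn n → ℂ) : ℝ :=
  ∫ x : Rn n, ((1/2 : ℝ) * ∑ i : Fin n, ‖fderiv ℝ f x (EuclideanSpace.single i 1)‖ ^ 2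
    + (1/4 : ℝ) * ‖f x‖ ^ 4)

/-- m₁ is a smooth, radially symmetric, nonincreasing multiplier with
m₁ = 1 on the unit ball, m₁(ξ) = |ξ|^{-(1-s)} for |ξ| ≥ 2, 0 < m₁ ≤ 1. -/
def IsAdmissibleMultiplier (n : ℕ) (s : ℝ) (m₁ : Rn n → ℝ) : Prop :=
  ContDiff ℝ (⊤ : ℕ∞) m₁ ∧
  (∀ ξ : Rn n, 0 < m₁ ξ ∧ m₁ ξ ≤ 1) ∧
  (∀ ξ η : Rn n, ‖ξ‖ = ‖η‖ → m₁ ξ = m₁ η) ∧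
  (∀ ξ η : Rn n, ‖ξ‖ ≤ ‖η‖ → m₁ η ≤ m₁ ξ) ∧
  (∀ ξ : Rn n, ‖ξ‖ ≤ 1 → m₁ ξ = 1) ∧
  (∀ ξ : Rn n, 2 ≤ ‖ξ‖ → m₁ ξ = ‖ξ‖ ^ (-(1 - s)))

/-- The rescaled multiplier m_N(ξ) = m₁(ξ/N). -/
def mN {n : ℕ} (m₁ : Rn n → ℝ) (N : ℝ) (ξ : Rn n) : ℝ := m₁ (N⁻¹ • ξ)

/-- The smoothing operator I_N with Fourier multiplier m_N. -/
def Iop {n : ℕ} (m₁ : Rn n → ℝ) (N : ℝ) (f : Rn n → ℂ) : Rn n → ℂ :=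
  fun x => 𝓕⁻ (fun ξ => (mN m₁ N ξ : ℂ) * 𝓕 f ξ) x

/-- The spatial multiplier ⟨∇⟩^s. -/
def japMul (n : ℕ) (s : ℝ) (f : Rn n → ℂ) : Rn n → ℂ :=
  fun x => 𝓕⁻ (fun ξ => ((jap ξ ^ s : ℝ) : ℂ) * 𝓕 f ξ) x

/-- Sharp Littlewood–Paley projection onto {M ≤ ⟨ξ⟩ ≤ 2M}. -/
def LP (n : ℕ) (M : ℝ) (f : Rn n → ℂ) : Rn n → ℂ :=
  fun x => 𝓕⁻ (fun ξ => if M ≤ jap ξ ∧ jap ξ ≤ 2 * M then 𝓕 f ξ else 0) x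

/-- Space-time Fourier transform ψ̃(ξ,τ). -/
def stFourier (n : ℕ) {E : Type*} [NormedAddCommGroup E] [NormedSpace ℂ E]
    (ψ : Rn n → ℝ → E) (ξ : Rn n) (τ : ℝ) : E :=
  ∫ x : Rn n, ∫ t : ℝ,
    Complex.exp (Complex.I * ((-2 * Real.pi * (⟪x, ξ⟫ + t * τ) : ℝ) : ℂ)) • ψ x t

/-- The X_{s,b} norm ‖⟨ξ⟩^s ⟨τ-|ξ|²⟩^b ψ̃‖_{L²}. -/
def XNorm (n : ℕ) {E : Type*} [NormedAddCommGroup E] [NormedSpace ℂ E]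
    (s b : ℝ) (ψ : Rn n → ℝ → E) : ℝ :=
  (∫ ξ : Rn n, ∫ τ : ℝ,
    jap ξ ^ (2 * s) * japR (τ - ‖ξ‖ ^ 2) ^ (2 * b) * ‖stFourier n ψ ξ τ‖ ^ 2) ^ (1/2 : ℝ)

/-- The restricted norm X^δ_{s,b}: infimum over Schwartz extensions off ℝⁿ × [0,δ]. -/
def XRNorm (n : ℕ) {E : Type*} [NormedAddCommGroup E] [NormedSpace ℂ E]
    (s b δ : ℝ) (f : Rn n → ℝ → E) : ℝ :=
  sInf { r : ℝ | ∃ ψ : SchwartzMap (Rn n × ℝ) E,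
    (∀ x : Rn n, ∀ t ∈ Icc (0:ℝ) δ, ψ (x, t) = f x t) ∧
    r = XNorm n s b (fun x t => ψ (x, t)) }

/-- Space-time L^p norm on ℝⁿ × ℝ. -/
def lpNormST (n : ℕ) {E : Type*} [NormedAddCommGroup E] (p : ℝ) (F : Rn n → ℝ → E) : ℝ :=
  (∫ t : ℝ, ∫ x : Rn n, ‖F x t‖ ^ p) ^ (1/p)

/-- Space-time L^p norm on ℝⁿ × [0,δ]. -/
def lpNormSTt (n : ℕ) {E : Type*} [NormedAddCommGroup E] (p δ : ℝ) (F : Rn n → ℝ → E) : ℝ :=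
  (∫ t in Icc (0:ℝ) δ, ∫ x : Rn n, ‖F x t‖ ^ p) ^ (1/p)

open scoped ENNReal

lemma lintegral_le_of_split {α : Type*} [MeasurableSpace α] {μ : Measure α}
    {κ h : α → ℝ≥0∞} (hκ : Measurable κ) (hh : Measurable h)
    {A : ℝ≥0∞} (hA : ∀ R : ℝ, 0 < R → ∃ S : Set α, MeasurableSet S ∧
      ∫⁻ y in S, κ y ∂μ ≤ A * ENNReal.ofReal (R ^ 4) ∧
      ∫⁻ y in Sᶜ, κ y ^ (10 : ℝ) ∂μ ≤ A * ENNReal.ofReal (R⁻¹ ^ 5))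
    {a : ℝ≥0∞} (ha : ∀ y, h y ≤ a) (ha0 : a ≠ 0) (hat : a ≠ ⊤)
    {N : ℝ≥0∞} (hN : ∫⁻ y, h y ^ (10 : ℝ) ∂μ ≤ N) (hN0 : N ≠ 0) (hNt : N ≠ ⊤) :
    ∫⁻ y, h y ^ (9 : ℝ) * κ y ∂μ ≤ (A + A ^ (1 / 10 : ℝ)) * (a * N ^ (4 / 5 : ℝ)) := by
  obtain ⟨a, rfl⟩ : ∃ b : ℝ, ENNReal.ofReal b = a := ⟨a.toReal, ENNReal.ofReal_toReal hat⟩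
  obtain ⟨N, rfl⟩ : ∃ b : ℝ, ENNReal.ofReal b = N := ⟨N.toReal, ENNReal.ofReal_toReal hNt⟩
  have ha0 : 0 < a := by simpa using ha0
  have hN0 : 0 < N := by simpa using hN0
  obtain ⟨S, hS, h1, h2⟩ := hA (N ^ (1 / 5 : ℝ) * a ^ (-2 : ℝ)) (by positivity)
  rw [← lintegral_add_compl _ hS, add_mul]
  refine add_le_add ?_ ?_
  · calc ∫⁻ y in S, h y ^ (9 : ℝ) * κ y ∂μ
        ≤ ∫⁻ y in S, ENNReal.ofReal a ^ (9 : ℝ) * κ y ∂μ := by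
          gcongr with y; exact ha y
      _ = ENNReal.ofReal a ^ (9 : ℝ) * ∫⁻ y in S, κ y ∂μ := lintegral_const_mul _ hκ
      _ ≤ ENNReal.ofReal a ^ (9 : ℝ) *
          (A * ENNReal.ofReal ((N ^ (1 / 5 : ℝ) * a ^ (-2 : ℝ)) ^ 4)) := by gcongr
      _ = _ := by
        rw [mul_left_comm]
        congr 1
        rw [ENNReal.ofReal_rpow_of_pos ha0, ENNReal.ofReal_rpow_of_pos hN0,
          ← ENNReal.ofReal_mul (by positivity), ← ENNReal.ofReal_mul (by positivity)]
        congr 1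
        rw [mul_pow, ← Real.rpow_mul_natCast hN0.le, ← Real.rpow_mul_natCast ha0.le,
          mul_left_comm, ← Real.rpow_add ha0]
        norm_num
        ring
  · have hol : (10 / 9 : ℝ).HolderConjugate 10 := by
      rw [Real.holderConjugate_iff]; norm_num
    calc ∫⁻ y in Sᶜ, h y ^ (9 : ℝ) * κ y ∂μ
        ≤ (∫⁻ y in Sᶜ, (h y ^ (9 : ℝ)) ^ (10 / 9 : ℝ) ∂μ) ^ (1 / (10 / 9) : ℝ) *
          (∫⁻ y in Sᶜ, κ y ^ (10 : ℝ) ∂μ) ^ (1 / 10 : ℝ) :=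
        ENNReal.lintegral_mul_le_Lp_mul_Lq _ hol (hh.pow_const _).aemeasurable hκ.aemeasurable
      _ ≤ (ENNReal.ofReal N) ^ (9 / 10 : ℝ) *
          (A * ENNReal.ofReal ((N ^ (1 / 5 : ℝ) * a ^ (-2 : ℝ))⁻¹ ^ 5)) ^ (1 / 10 : ℝ) := by
        simp_rw [← ENNReal.rpow_mul]
        norm_num only
        gcongr
        exact (setLIntegral_le_lintegral _ _).trans hN
      _ = _ := by
        rw [ENNReal.mul_rpow_of_nonneg _ _ (by norm_num), mul_left_comm]
        congr 1
        rw [ENNReal.ofReal_rpow_of_pos hN0, ENNReal.ofReal_rpow_of_pos (by positivity),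
          ENNReal.ofReal_rpow_of_pos hN0,
          ← ENNReal.ofReal_mul (by positivity), ← ENNReal.ofReal_mul (by positivity)]
        congr 1
        rw [← Real.rpow_natCast, ← Real.rpow_mul (by positivity), ← Real.rpow_neg_one,
          ← Real.rpow_mul (by positivity),
          Real.mul_rpow (by positivity) (by positivity),
          ← Real.rpow_mul hN0.le, ← Real.rpow_mul ha0.le, ← mul_assoc, ← Real.rpow_add hN0,
          mul_comm a]
        norm_num

/-- A Hardy–Littlewood–Sobolev inequality for kernels of weak-`L⁵` type. -/
lemma lintegral_lintegral_hls {α : Type*} [MeasurableSpace α] {μ : Measure α} [SFinite μ]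
    {κ : α → α → ℝ≥0∞} (hκ : Measurable (Function.uncurry κ)) (hsymm : ∀ x y, κ x y = κ y x)
    {A : ℝ≥0∞} (hA : ∀ x, ∀ R : ℝ, 0 < R → ∃ S : Set α, MeasurableSet S ∧
      ∫⁻ y in S, κ x y ∂μ ≤ A * ENNReal.ofReal (R ^ 4) ∧
      ∫⁻ y in Sᶜ, κ x y ^ (10 : ℝ) ∂μ ≤ A * ENNReal.ofReal (R⁻¹ ^ 5))
    {h : α → ℝ≥0∞} (hh : Measurable h) (hht : ∀ x, h x ≠ ⊤)
    (hN0 : ∫⁻ y, h y ^ (10 : ℝ) ∂μ ≠ 0) (hNt : ∫⁻ y, h y ^ (10 : ℝ) ∂μ ≠ ⊤) :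
    ∫⁻ x, ∫⁻ y, h x ^ (9 : ℝ) * (h y ^ (9 : ℝ) * κ x y) ∂μ ∂μ ≤
      2 * ((A + A ^ (1 / 10 : ℝ)) * (∫⁻ y, h y ^ (10 : ℝ) ∂μ) ^ (9 / 5 : ℝ)) := by
  classical
  set N := ∫⁻ y, h y ^ (10 : ℝ) ∂μ
  set F : α → α → ℝ≥0∞ := fun x y => h x ^ (9 : ℝ) * (h y ^ (9 : ℝ) * κ x y)
  set G : α → α → ℝ≥0∞ := fun x y => if h y ≤ h x then F x y else 0
  have hF : Measurable (Function.uncurry F) := by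
    have h1 : Measurable fun p : α × α => h p.1 := hh.comp measurable_fst
    have h2 : Measurable fun p : α × α => h p.2 := hh.comp measurable_snd
    exact (h1.pow_const _).mul ((h2.pow_const _).mul hκ)
  have hG : Measurable (Function.uncurry G) :=
    Measurable.ite (measurableSet_le (hh.comp measurable_snd) (hh.comp measurable_fst)) hF
      measurable_const
  have hFG : ∀ x y, F x y ≤ G x y + G y x := by
    intro x y
    have : F x y = F y x := by simp only [F, hsymm x y]; ring
    simp only [G]
    rcases le_total (h x) (h y) with hxy | hxy
    · simp [hxy, this]
    · simp [hxy]
  have hbound : ∫⁻ x, ∫⁻ y, G x y ∂μ ∂μ ≤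
      (A + A ^ (1 / 10 : ℝ)) * N ^ (9 / 5 : ℝ) := by
    calc ∫⁻ x, ∫⁻ y, G x y ∂μ ∂μ
        ≤ ∫⁻ x, (A + A ^ (1 / 10 : ℝ)) * N ^ (4 / 5 : ℝ) * h x ^ (10 : ℝ) ∂μ := by
          refine lintegral_mono fun x => ?_
          rcases eq_or_ne (h x) 0 with hx | hx
          · simp [G, F, hx]
          have := lintegral_le_of_split (μ := μ) (κ := κ x)
            (h := fun y => if h y ≤ h x then h y else 0) hκ.of_uncurry_left
            (Measurable.ite (measurableSet_le hh measurable_const) hh measurable_const)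
            (hA x) (a := h x) (fun y => by split_ifs with hy; exacts [hy, zero_le])
            hx (hht x) (N := N)
            (lintegral_mono fun y => by split_ifs <;> simp) hN0 hNt
          calc ∫⁻ y, G x y ∂μ
              = h x ^ (9 : ℝ) *
                ∫⁻ y, (if h y ≤ h x then h y else 0) ^ (9 : ℝ) * κ x y ∂μ := by
                rw [← lintegral_const_mul]
                · refine lintegral_congr fun y => ?_
                  simp only [G, F]; split_ifs <;> simp
                · exact ((Measurable.ite (measurableSet_le hh measurable_const) hh
                    measurable_const).pow_const _).mul hκ.of_uncurry_left
            _ ≤ h x ^ (9 : ℝ) * ((A + A ^ (1 / 10 : ℝ)) * (h x * N ^ (4 / 5 : ℝ))) := by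
                gcongr
            _ = _ := by
                rw [show (10 : ℝ) = 9 + 1 by norm_num, ENNReal.rpow_add _ _ hx (hht x),
                  ENNReal.rpow_one]
                ring
      _ = (A + A ^ (1 / 10 : ℝ)) * N ^ (4 / 5 : ℝ) * N :=
          lintegral_const_mul _ (hh.pow_const _)
      _ = _ := by
          rw [show (9 / 5 : ℝ) = 4 / 5 + 1 by norm_num, ENNReal.rpow_add _ _ hN0 hNt,
            ENNReal.rpow_one, mul_assoc]
  calc ∫⁻ x, ∫⁻ y, F x y ∂μ ∂μ
      ≤ ∫⁻ x, ∫⁻ y, (G x y + G y x) ∂μ ∂μ :=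
        lintegral_mono fun x => lintegral_mono fun y => hFG x y
    _ = ∫⁻ x, ∫⁻ y, G x y ∂μ ∂μ + ∫⁻ x, ∫⁻ y, G y x ∂μ ∂μ := by
        rw [← lintegral_add_left (f := fun x => ∫⁻ y, G x y ∂μ) hG.lintegral_prod_right']
        exact lintegral_congr fun x => lintegral_add_left hG.of_uncurry_left _
    _ = 2 * ∫⁻ x, ∫⁻ y, G x y ∂μ ∂μ := by
        rw [lintegral_lintegral_swap (f := fun x y => G y x), two_mul]
        exact (hG.comp measurable_swap).aemeasurable
    _ ≤ _ := by gcongr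

lemma lintegral_eq_scale {E : Type*} [NormedAddCommGroup E] [NormedSpace ℝ E]
    [FiniteDimensional ℝ E] [MeasurableSpace E] [BorelSpace E] (μ : Measure E)
    [μ.IsAddHaarMeasure] {f : E → ℝ≥0∞} (hf : Measurable f) {R : ℝ} (hR : 0 < R) :
    ∫⁻ x, f x ∂μ = ENNReal.ofReal (R ^ Module.finrank ℝ E) * ∫⁻ x, f (R • x) ∂μ := by
  have h := lintegral_map (μ := μ) hf (measurable_const_smul R)
  rw [Measure.map_addHaar_smul μ hR.ne', lintegral_smul_measure, abs_of_pos (by positivity)] at h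
  rw [← h, smul_eq_mul, ← mul_assoc, ← ENNReal.ofReal_mul (by positivity),
    mul_inv_cancel₀ (by positivity)]
  simp

/-- The parabolic quasi-norm on space-time. -/
def parabolicNorm (p : Rn 3 × ℝ) : ℝ := max ‖p.1‖ (Real.sqrt |p.2|)

lemma measurable_parabolicNorm : Measurable parabolicNorm := by
  unfold parabolicNorm
  fun_prop

lemma lintegral_inv_norm_ball :
    ∃ A : ℝ≥0∞, A ≠ ⊤ ∧ ∀ R : ℝ, 0 < R →
      ∫⁻ x in Metric.ball (0 : Rn 3) R, (ENNReal.ofReal ‖x‖)⁻¹ ≤ A * ENNReal.ofReal (R ^ 2) := by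
  refine ⟨∫⁻ x in Metric.ball (0 : Rn 3) 1, (ENNReal.ofReal ‖x‖)⁻¹, ?_, fun R hR => ?_⟩
  · have h := integrableOn_ball_of_norm_le_rpow (μ := (volume : Measure (Rn 3)))
      (f := fun x => ‖x‖⁻¹) (C := 1) (α := 1) (r := 1) (by simp) (by simp)
      (.of_forall fun x => by simp [Real.rpow_neg_one]) (by fun_prop)
    have h2 := h.lintegral_lt_top
    refine ne_of_lt (lt_of_eq_of_lt (lintegral_congr_ae ?_) h2)
    have : ∀ᵐ x : Rn 3, x ≠ 0 := by
      simp [ae_iff]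
    filter_upwards [ae_restrict_of_ae this] with x hx
    rw [ENNReal.ofReal_inv_of_pos (norm_pos_iff.2 hx)]
  · rw [← lintegral_indicator measurableSet_ball, ← lintegral_indicator measurableSet_ball,
      lintegral_eq_scale volume (Measurable.indicator (by fun_prop) measurableSet_ball) hR,
      ← lintegral_const_mul' _ _ ENNReal.ofReal_ne_top,
      ← lintegral_mul_const' _ _ ENNReal.ofReal_ne_top]
    refine lintegral_mono fun x => ?_
    by_cases hx : ‖x‖ < 1
    · have : ‖R • x‖ < R := by rw [norm_smul, Real.norm_of_nonneg hR.le]; nlinarith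
      rw [indicator_of_mem (by simpa using this), indicator_of_mem (by simpa using hx),
        norm_smul, Real.norm_of_nonneg hR.le, ENNReal.ofReal_mul hR.le,
        ENNReal.mul_inv (by simp [hR]) (by simp), ← mul_assoc, mul_comm]
      gcongr
      rw [← ENNReal.ofReal_inv_of_pos hR, ← ENNReal.ofReal_mul (by positivity)]
      simp only [finrank_euclideanSpace, Fintype.card_fin]
      apply le_of_eq
      congr 1
      field_simp
    · have : ¬ ‖R • x‖ < R := by rw [norm_smul, Real.norm_of_nonneg hR.le]; nlinarith
      rw [indicator_of_notMem (by simpa using this)]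
      simp

lemma lintegral_inv_add_norm_rpow {E : Type*} [NormedAddCommGroup E] [NormedSpace ℝ E]
    [FiniteDimensional ℝ E] [MeasurableSpace E] [BorelSpace E] (μ : Measure E)
    [μ.IsAddHaarMeasure] {m : ℕ} (hm : Module.finrank ℝ E < m) :
    ∃ A : ℝ≥0∞, A ≠ ⊤ ∧ ∀ R : ℝ, 0 < R →
      ∫⁻ x, ENNReal.ofReal ((R + ‖x‖)⁻¹ ^ m) ∂μ =
        A * ENNReal.ofReal (R ^ Module.finrank ℝ E * R⁻¹ ^ m) := by
  refine ⟨∫⁻ x, ENNReal.ofReal ((1 + ‖x‖)⁻¹ ^ m) ∂μ, ?_, fun R hR => ?_⟩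
  · have h := finite_integral_one_add_norm (μ := μ) (E := E) (r := m) (by exact_mod_cast hm)
    refine ne_of_lt (lt_of_eq_of_lt (lintegral_congr fun x => ?_) h)
    rw [Real.rpow_neg (by positivity), Real.rpow_natCast, inv_pow]
  · rw [lintegral_eq_scale μ (by fun_prop) hR, ENNReal.ofReal_mul (by positivity), mul_left_comm]
    congr 1
    rw [← lintegral_mul_const _ (by fun_prop)]
    refine lintegral_congr fun x => ?_
    rw [← ENNReal.ofReal_mul (by positivity), norm_smul, Real.norm_of_nonneg hR.le, ← mul_pow,
      ← mul_inv]
    congr 3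
    ring

lemma parabolic_kernel_split :
    ∃ A : ℝ≥0∞, A ≠ ⊤ ∧ ∀ R : ℝ, 0 < R →
      ∫⁻ p in {p | parabolicNorm p < R}, (ENNReal.ofReal (parabolicNorm p))⁻¹ ≤
        A * ENNReal.ofReal (R ^ 4) ∧
      ∫⁻ p in {p | parabolicNorm p < R}ᶜ, (ENNReal.ofReal (parabolicNorm p))⁻¹ ^ (10 : ℝ) ≤
        A * ENNReal.ofReal (R⁻¹ ^ 5) := by
  obtain ⟨A, hA, h1⟩ := lintegral_inv_norm_ball
  obtain ⟨B, hB, h2⟩ := lintegral_inv_add_norm_rpow (volume : Measure (Rn 3)) (m := 6) (by simp)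
  obtain ⟨D, hD, h3⟩ := lintegral_inv_add_norm_rpow (volume : Measure ℝ) (m := 2) (by simp)
  refine ⟨2 * A + ENNReal.ofReal (2 ^ 8) * (B * D), by finiteness, fun R hR => ⟨?_, ?_⟩⟩
  · have hS : {p | parabolicNorm p < R} ⊆ Metric.ball (0 : Rn 3) R ×ˢ Metric.ball (0 : ℝ) (R ^ 2) := by
      intro p hp
      simp only [parabolicNorm, mem_ofPred_eq, max_lt_iff, Real.sqrt_lt' hR] at hp
      simpa using hp
    calc ∫⁻ p in {p | parabolicNorm p < R}, (ENNReal.ofReal (parabolicNorm p))⁻¹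
        ≤ ∫⁻ p in Metric.ball (0 : Rn 3) R ×ˢ Metric.ball (0 : ℝ) (R ^ 2),
            (ENNReal.ofReal (parabolicNorm p))⁻¹ := lintegral_mono_set hS
      _ ≤ ∫⁻ p in Metric.ball (0 : Rn 3) R ×ˢ Metric.ball (0 : ℝ) (R ^ 2),
            (ENNReal.ofReal ‖p.1‖)⁻¹ * 1 := by
          refine lintegral_mono fun p => ?_
          rw [mul_one]
          gcongr
          exact le_max_left _ _
      _ = (∫⁻ x in Metric.ball (0 : Rn 3) R, (ENNReal.ofReal ‖x‖)⁻¹) *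
            ∫⁻ t in Metric.ball (0 : ℝ) (R ^ 2), 1 := by
          rw [Measure.volume_eq_prod, ← Measure.prod_restrict]
          exact lintegral_prod_mul (f := fun x : Rn 3 => (ENNReal.ofReal ‖x‖)⁻¹)
            (g := fun _ : ℝ => 1) (by fun_prop) (by fun_prop)
      _ ≤ (A * ENNReal.ofReal (R ^ 2)) * ENNReal.ofReal (2 * R ^ 2) := by
          gcongr
          · exact h1 R hR
          · simp
      _ = 2 * A * ENNReal.ofReal (R ^ 4) := by
          rw [mul_assoc, ← ENNReal.ofReal_mul (by positivity), mul_comm 2 A, mul_assoc]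
          congr 1
          rw [show (2 : ℝ≥0∞) = ENNReal.ofReal 2 by simp, ← ENNReal.ofReal_mul (by positivity)]
          congr 1; ring
      _ ≤ _ := by gcongr; exact le_self_add
  · calc ∫⁻ p in {p | parabolicNorm p < R}ᶜ, (ENNReal.ofReal (parabolicNorm p))⁻¹ ^ (10 : ℝ)
        ≤ ∫⁻ p in {p | parabolicNorm p < R}ᶜ, ENNReal.ofReal (2 ^ 8) *
            (ENNReal.ofReal ((R + ‖p.1‖)⁻¹ ^ 6) * ENNReal.ofReal ((R ^ 2 + ‖p.2‖)⁻¹ ^ 2)) := by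
          refine setLIntegral_mono' (measurableSet_lt measurable_parabolicNorm
            measurable_const).compl fun p hp => ?_
          have hp' : R ≤ parabolicNorm p := by simpa using hp
          have hp0 : 0 < parabolicNorm p := hR.trans_le hp'
          rw [← ENNReal.ofReal_inv_of_pos hp0, ENNReal.ofReal_rpow_of_pos (by positivity),
            ← ENNReal.ofReal_mul (by positivity), ← ENNReal.ofReal_mul (by positivity)]
          apply ENNReal.ofReal_le_ofReal
          have k1 : R + ‖p.1‖ ≤ 2 * parabolicNorm p := by
            have : ‖p.1‖ ≤ parabolicNorm p := le_max_left _ _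
            linarith
          have k2 : R ^ 2 + ‖p.2‖ ≤ 2 * parabolicNorm p ^ 2 := by
            have : Real.sqrt |p.2| ≤ parabolicNorm p := le_max_right _ _
            have h4 : |p.2| ≤ parabolicNorm p ^ 2 := (Real.sqrt_le_left hp0.le).1 this
            have h5 : R ^ 2 ≤ parabolicNorm p ^ 2 := by gcongr
            rw [Real.norm_eq_abs]; linarith
          calc (parabolicNorm p)⁻¹ ^ (10 : ℝ) =
              2 ^ 8 * ((2 * parabolicNorm p)⁻¹ ^ 6 * (2 * parabolicNorm p ^ 2)⁻¹ ^ 2) := by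
                rw [show (10 : ℝ) = (10 : ℕ) by norm_num, Real.rpow_natCast]
                field_simp
            _ ≤ _ := by gcongr
      _ ≤ ∫⁻ p : Rn 3 × ℝ, ENNReal.ofReal (2 ^ 8) *
            (ENNReal.ofReal ((R + ‖p.1‖)⁻¹ ^ 6) * ENNReal.ofReal ((R ^ 2 + ‖p.2‖)⁻¹ ^ 2)) :=
          setLIntegral_le_lintegral _ _
      _ = ENNReal.ofReal (2 ^ 8) * ((B * ENNReal.ofReal (R ^ 3 * R⁻¹ ^ 6)) *
            (D * ENNReal.ofReal ((R ^ 2) ^ 1 * (R ^ 2)⁻¹ ^ 2))) := by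
          rw [lintegral_const_mul _ (by fun_prop), Measure.volume_eq_prod,
            lintegral_prod_mul (f := fun x : Rn 3 => ENNReal.ofReal ((R + ‖x‖)⁻¹ ^ 6))
              (g := fun t : ℝ => ENNReal.ofReal ((R ^ 2 + ‖t‖)⁻¹ ^ 2)) (by fun_prop)
              (by fun_prop), h2 R hR, h3 (R ^ 2) (by positivity)]
          simp
      _ = ENNReal.ofReal (2 ^ 8) * (B * D) * ENNReal.ofReal (R⁻¹ ^ 5) := by
          rw [mul_mul_mul_comm, ← ENNReal.ofReal_mul (by positivity),
            mul_assoc (ENNReal.ofReal _) (B * D)]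
          congr 3
          field_simp
      _ ≤ _ := by gcongr; exact le_add_self

/-- `∫₀^∞ min(s^{-3/2}, D^{-3/4}s^{-3/4}) ds = 6 D^{-1/2}`. -/
lemma lintegral_heat_majorant {ρ : ℝ} (hρ : 0 < ρ) {k : ℝ → ℝ}
    (h1 : ∀ s, ρ ^ 2 < s → k s ≤ s ^ (-(3 / 2) : ℝ))
    (h2 : ∀ s, 0 < s → s ≤ ρ ^ 2 → k s ≤ ρ ^ (-(3 / 2) : ℝ) * s ^ (-(3 / 4) : ℝ)) :
    ∫⁻ s in Ioi (0 : ℝ), ENNReal.ofReal (k s) ≤ ENNReal.ofReal (6 * ρ⁻¹) := by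
  have hD : 0 < ρ ^ 2 := by positivity
  rw [← Ioc_union_Ioi_eq_Ioi hD.le, lintegral_union measurableSet_Ioi
    (Set.Ioc_disjoint_Ioi le_rfl)]
  have e1 : ∫⁻ s in Ioc 0 (ρ ^ 2), ENNReal.ofReal (k s) ≤ ENNReal.ofReal (4 * ρ⁻¹) := by
    have hi : IntervalIntegrable (fun s : ℝ => s ^ (-(3 / 4) : ℝ)) volume 0 (ρ ^ 2) :=
      intervalIntegral.intervalIntegrable_rpow' (by norm_num)
    have hi' := (intervalIntegrable_iff_integrableOn_Ioc_of_le hD.le).1 hi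
    calc ∫⁻ s in Ioc 0 (ρ ^ 2), ENNReal.ofReal (k s)
        ≤ ∫⁻ s in Ioc 0 (ρ ^ 2), ENNReal.ofReal (ρ ^ (-(3 / 2) : ℝ) * s ^ (-(3 / 4) : ℝ)) :=
          setLIntegral_mono' measurableSet_Ioc fun s hs =>
            ENNReal.ofReal_le_ofReal (h2 s hs.1 hs.2)
      _ = ENNReal.ofReal (∫ s in Ioc 0 (ρ ^ 2), ρ ^ (-(3 / 2) : ℝ) * s ^ (-(3 / 4) : ℝ)) := by
          rw [ofReal_integral_eq_lintegral_ofReal (hi'.const_mul _)]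
          filter_upwards [ae_restrict_mem measurableSet_Ioc] with s hs
          have := hs.1
          positivity
      _ = _ := by
          congr 1
          rw [integral_const_mul, ← intervalIntegral.integral_of_le hD.le,
            integral_rpow (Or.inl (by norm_num)), ← Real.rpow_natCast, ← Real.rpow_mul hρ.le,
            Real.zero_rpow (by norm_num), sub_zero, mul_div_assoc', ← Real.rpow_add hρ,
            ← Real.rpow_neg_one]
          norm_num
          ring
  have e2 : ∫⁻ s in Ioi (ρ ^ 2), ENNReal.ofReal (k s) ≤ ENNReal.ofReal (2 * ρ⁻¹) := by
    have hi := integrableOn_Ioi_rpow_of_lt (a := (-(3 / 2) : ℝ)) (by norm_num) hD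
    calc ∫⁻ s in Ioi (ρ ^ 2), ENNReal.ofReal (k s)
        ≤ ∫⁻ s in Ioi (ρ ^ 2), ENNReal.ofReal (s ^ (-(3 / 2) : ℝ)) :=
          setLIntegral_mono' measurableSet_Ioi fun s hs => ENNReal.ofReal_le_ofReal (h1 s hs)
      _ = ENNReal.ofReal (∫ s in Ioi (ρ ^ 2), s ^ (-(3 / 2) : ℝ)) := by
          rw [ofReal_integral_eq_lintegral_ofReal hi]
          filter_upwards [ae_restrict_mem measurableSet_Ioi] with s hs
          have : 0 < s := hD.trans hs
          positivity
      _ = _ := by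
          congr 1
          rw [integral_Ioi_rpow_of_lt (by norm_num) hD, ← Real.rpow_natCast,
            ← Real.rpow_mul hρ.le, ← Real.rpow_neg_one]
          norm_num
          ring
  refine (add_le_add e1 e2).trans_eq ?_
  rw [← ENNReal.ofReal_add (by positivity) (by positivity)]
  congr 1; ring

/-- The absolute value of the kernel of the regularised Schrödinger propagator. -/
def heatSchrodinger (r t s : ℝ) : ℝ :=
  (s ^ 2 + 4 * t ^ 2) ^ (-(3 / 4) : ℝ) * Real.exp (-(Real.pi * r ^ 2 * s / (s ^ 2 + 4 * t ^ 2)))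

lemma heatSchrodinger_le_of_pos {s : ℝ} (hs : 0 < s) (r t : ℝ) :
    heatSchrodinger r t s ≤ (s ^ 2 + 4 * t ^ 2) ^ (-(3 / 4) : ℝ) := by
  refine mul_le_of_le_one_right (by positivity) (Real.exp_le_one_iff.2 ?_)
  have : 0 ≤ Real.pi * r ^ 2 * s / (s ^ 2 + 4 * t ^ 2) := by positivity
  linarith

lemma heatSchrodinger_le_radial {s r : ℝ} (hs : 0 < s) (hr : 0 < r) (t : ℝ) :
    heatSchrodinger r t s ≤ r ^ (-(3 / 2) : ℝ) * s ^ (-(3 / 4) : ℝ) := by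
  set q := s ^ 2 + 4 * t ^ 2 with hq
  have hq0 : 0 < q := by positivity
  set y := r ^ 2 * s / q with hy
  have hy0 : 0 < y := by positivity
  have key : Real.exp (-(Real.pi * r ^ 2 * s / q)) ≤ y ^ (-(3 / 4) : ℝ) := by
    have h1 : y ^ (3 / 4 : ℝ) ≤ Real.exp y := by
      calc y ^ (3 / 4 : ℝ) ≤ (y + 1) ^ (3 / 4 : ℝ) := by gcongr; linarith
        _ ≤ (y + 1) ^ (1 : ℝ) := Real.rpow_le_rpow_of_exponent_le (by linarith) (by norm_num)
        _ ≤ _ := by rw [Real.rpow_one]; exact Real.add_one_le_exp y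
    calc Real.exp (-(Real.pi * r ^ 2 * s / q)) ≤ Real.exp (-y) := by
          rw [Real.exp_le_exp, neg_le_neg_iff]
          have : Real.pi * r ^ 2 * s / q = Real.pi * y := by rw [hy]; ring
          rw [this]
          nlinarith [Real.pi_gt_three]
      _ = (Real.exp y)⁻¹ := Real.exp_neg y
      _ ≤ (y ^ (3 / 4 : ℝ))⁻¹ := by gcongr
      _ = _ := (Real.rpow_neg hy0.le _).symm
  calc heatSchrodinger r t s ≤ q ^ (-(3 / 4) : ℝ) * y ^ (-(3 / 4) : ℝ) := by
        unfold heatSchrodinger; gcongr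
    _ = (r ^ 2) ^ (-(3 / 4) : ℝ) * s ^ (-(3 / 4) : ℝ) := by
        rw [← Real.mul_rpow hq0.le hy0.le, ← Real.mul_rpow (by positivity) hs.le, hy,
          mul_div_cancel₀ _ hq0.ne']
    _ = _ := by
        rw [← Real.rpow_natCast, ← Real.rpow_mul hr.le]; norm_num

lemma lintegral_heatSchrodinger_le {r t : ℝ} (h : 0 < max r (Real.sqrt |t|)) :
    ∫⁻ s in Ioi (0 : ℝ), ENNReal.ofReal (heatSchrodinger r t s) ≤
      ENNReal.ofReal (6 * (max r (Real.sqrt |t|))⁻¹) := by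
  have aux : ∀ {s u q : ℝ}, 0 < u → u ^ 2 ≤ q → q ^ (-(3 / 4) : ℝ) ≤ u ^ (-(3 / 2) : ℝ) := by
    intro s u q hu huq
    calc q ^ (-(3 / 4) : ℝ) ≤ (u ^ 2) ^ (-(3 / 4) : ℝ) :=
          Real.rpow_le_rpow_of_nonpos (by positivity) huq (by norm_num)
      _ = _ := by rw [← Real.rpow_natCast, ← Real.rpow_mul hu.le]; norm_num
  refine lintegral_heat_majorant h (fun s hs => ?_) (fun s hs hsρ => ?_)
  · have hs0 : 0 < s := (by positivity : (0 : ℝ) ≤ _).trans_lt hs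
    exact (heatSchrodinger_le_of_pos hs0 r t).trans (aux (s := s) hs0 (by nlinarith [sq_nonneg t]))
  · rcases le_total (Real.sqrt |t|) r with hrt | hrt
    · rw [max_eq_left hrt] at *
      exact heatSchrodinger_le_radial hs h t
    · rw [max_eq_right hrt] at *
      have ht : 0 < |t| := Real.sqrt_pos.1 h
      rw [Real.sq_sqrt ht.le] at hsρ
      calc heatSchrodinger r t s ≤ _ := heatSchrodinger_le_of_pos hs r t
        _ ≤ |t| ^ (-(3 / 2) : ℝ) :=
          aux (s := s) ht (by rw [sq_abs]; nlinarith [sq_nonneg t, sq_nonneg s])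
        _ = |t| ^ (-(3 / 4) : ℝ) * |t| ^ (-(3 / 4) : ℝ) := by
          rw [← Real.rpow_add ht]; norm_num
        _ ≤ |t| ^ (-(3 / 4) : ℝ) * s ^ (-(3 / 4) : ℝ) := by
          gcongr ?_ * ?_
          exact Real.rpow_le_rpow_of_nonpos hs hsρ (by norm_num)
        _ = _ := by
          rw [Real.sqrt_eq_rpow, ← Real.rpow_mul ht.le]; norm_num

/-- The quadratic form of a Fourier multiplier is dominated by the convolution with the absolute
value of its kernel. -/
lemma lintegral_multiplier_le {V : Type*} [NormedAddCommGroup V] [InnerProductSpace ℝ V]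
    [FiniteDimensional ℝ V] [MeasurableSpace V] [BorelSpace V] {m : V → ℝ} (hm : Integrable m)
    (hm0 : ∀ v, 0 ≤ m v) {G : V → ℂ} (hG : Integrable G) :
    ∫⁻ v, ENNReal.ofReal (m v) * ‖𝓕 G v‖ₑ ^ 2 ≤
      ∫⁻ z, ∫⁻ w, ‖G z‖ₑ * (‖G w‖ₑ * ‖𝓕 (fun v => (m v : ℂ)) (w - z)‖ₑ) := by
  have hmc : Integrable (fun v => (m v : ℂ)) := hm.ofReal
  have hcont : Continuous (𝓕 G) :=
    VectorFourier.fourierIntegral_continuous Real.continuous_fourierChar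
      (L := innerₗ V) continuous_inner hG
  have hbd : ∀ v, ‖𝓕 G v‖ ≤ ∫ x, ‖G x‖ := fun v =>
    VectorFourier.norm_fourierIntegral_le_integral_norm _ _ _ _ _
  have hmG : Integrable (fun v => (m v : ℂ) * 𝓕 G v) :=
    hmc.mul_bdd hcont.aestronglyMeasurable (.of_forall hbd)
  have hint : Integrable (fun v => m v * ‖𝓕 G v‖ ^ 2) := by
    refine hm.mul_bdd (c := (∫ x, ‖G x‖) ^ 2)
      (by fun_prop : Continuous fun v => ‖𝓕 G v‖ ^ 2).aestronglyMeasurable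
      (.of_forall fun v => ?_)
    rw [norm_pow, norm_norm]
    gcongr
    exact hbd v
  have h1 : ((∫ v, m v * ‖𝓕 G v‖ ^ 2 : ℝ) : ℂ) =
      ∫ z, inner ℂ (G z) (VectorFourier.fourierIntegral Real.fourierChar volume (-(innerₗ V).flip)
        (fun v => (m v : ℂ) * 𝓕 G v) z) := by
    rw [← integral_complex_ofReal]
    refine Eq.trans (integral_congr_ae (.of_forall fun v => ?_))
      (VectorFourier.integral_sesq_fourierIntegral_eq_neg_flip (innerSL ℂ) (L := innerₗ V)
        Real.continuous_fourierChar continuous_inner hG hmG)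
    change _ = inner ℂ (𝓕 G v) ((m v : ℂ) * 𝓕 G v)
    rw [RCLike.inner_apply, mul_assoc, Complex.mul_conj, Complex.normSq_eq_norm_sq]
    push_cast
    rfl
  have h2 : ∀ z, VectorFourier.fourierIntegral Real.fourierChar volume (-(innerₗ V).flip)
      (fun v => (m v : ℂ) * 𝓕 G v) z = ∫ w, G w * 𝓕 (fun v => (m v : ℂ)) (w - z) := by
    intro z
    have hg : Integrable (fun v => (Real.fourierChar ⟪v, z⟫ : Circle) • (m v : ℂ)) := by
      have := (VectorFourier.fourierIntegral_convergent_iff (μ := (volume : Measure V))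
        Real.continuous_fourierChar (L := innerₗ V) continuous_inner (-z)).2 hmc
      simpa using this
    have := VectorFourier.integral_fourierIntegral_smul_eq_flip (L := innerₗ V)
        (μ := (volume : Measure V)) (ν := (volume : Measure V))
        Real.continuous_fourierChar continuous_inner hG hg
    refine Eq.trans (integral_congr_ae (.of_forall fun v => ?_))
      (this.trans (integral_congr_ae (.of_forall fun w => ?_)))
    · change _ = 𝓕 G v • _
      simp [Circle.smul_def]
      rw [real_inner_comm]
      ring
    · dsimp only
      rw [smul_eq_mul]
      congr 1
      rw [Real.fourier_eq]
      refine integral_congr_ae (.of_forall fun v => ?_)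
      simp only [LinearMap.flip_apply, innerₗ_apply_apply, smul_smul, ← AddChar.map_add_eq_mul]
      congr 2
      rw [inner_sub_right, real_inner_comm]
      ring
  calc ∫⁻ v, ENNReal.ofReal (m v) * ‖𝓕 G v‖ₑ ^ 2
      = ∫⁻ v, ENNReal.ofReal (m v * ‖𝓕 G v‖ ^ 2) := by
        refine lintegral_congr fun v => ?_
        rw [ENNReal.ofReal_mul (hm0 v), ENNReal.ofReal_pow (norm_nonneg _), ofReal_norm]
    _ = ENNReal.ofReal (∫ v, m v * ‖𝓕 G v‖ ^ 2) := by
        rw [ofReal_integral_eq_lintegral_ofReal hint]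
        exact .of_forall fun v => mul_nonneg (hm0 v) (by positivity)
    _ ≤ ‖((∫ v, m v * ‖𝓕 G v‖ ^ 2 : ℝ) : ℂ)‖ₑ := by
        rw [← ofReal_norm, Complex.norm_real]
        exact ENNReal.ofReal_le_ofReal (le_abs_self _)
    _ ≤ ∫⁻ z, ‖inner ℂ (G z) (∫ w, G w * 𝓕 (fun v => (m v : ℂ)) (w - z))‖ₑ := by
        rw [h1]
        simp_rw [h2]
        exact enorm_integral_le_lintegral_enorm _
    _ ≤ _ := by
        refine lintegral_mono fun z => ?_
        rw [RCLike.inner_apply, enorm_mul, RCLike.enorm_conj, mul_comm,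
          lintegral_const_mul' _ _ (by simp)]
        gcongr
        refine (enorm_integral_le_lintegral_enorm _).trans_eq ?_
        simp_rw [enorm_mul]

/-- Space-time with its Euclidean structure. -/
abbrev SpaceTime := WithLp 2 (Rn 3 × ℝ)

/-- The multiplier `π e^{-πs|ξ|²} J(τ - |ξ|²)`. -/
def heatMultiplier (J : ℝ → ℝ) (s : ℝ) (v : SpaceTime) : ℝ :=
  Real.pi * Real.exp (-(Real.pi * s * ‖v.ofLp.1‖ ^ 2)) * J (v.ofLp.2 - ‖v.ofLp.1‖ ^ 2)

lemma integrable_heatMultiplier_prod {J : ℝ → ℝ} (hJ : Integrable J) (hJm : Measurable J) {s : ℝ}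
    (hs : 0 < s) :
    Integrable fun p : Rn 3 × ℝ => heatMultiplier J s (WithLp.toLp 2 p) := by
  have hmeas : Measurable fun p : Rn 3 × ℝ => heatMultiplier J s (WithLp.toLp 2 p) := by
    unfold heatMultiplier
    fun_prop
  have hgauss : Integrable fun x : Rn 3 => Real.exp (-(Real.pi * s * ‖x‖ ^ 2)) := by
    have := (GaussianFourier.integrable_cexp_neg_mul_sq_norm_add (V := Rn 3)
      (b := ((Real.pi * s : ℝ) : ℂ)) (by simpa using mul_pos Real.pi_pos hs) 0 0).norm
    refine this.congr (.of_forall fun x => ?_)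
    simp [Complex.norm_exp, ← Complex.ofReal_pow]
  rw [Measure.volume_eq_prod, integrable_prod_iff hmeas.aestronglyMeasurable]
  refine ⟨.of_forall fun x => (hJ.comp_sub_right (‖x‖ ^ 2)).const_mul
    (Real.pi * Real.exp (-(Real.pi * s * ‖x‖ ^ 2))), ?_⟩
  have : ∀ x : Rn 3, ∫ t, ‖heatMultiplier J s (WithLp.toLp 2 (x, t))‖ =
      Real.exp (-(Real.pi * s * ‖x‖ ^ 2)) * (Real.pi * ∫ t, ‖J t‖) := by
    intro x
    simp only [heatMultiplier, norm_mul]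
    rw [integral_const_mul, integral_sub_right_eq_self (fun t => ‖J t‖), Real.norm_of_nonneg
      Real.pi_pos.le, Real.norm_of_nonneg (Real.exp_nonneg _)]
    ring
  simp_rw [this]
  exact hgauss.mul_const _

lemma integrable_heatMultiplier {J : ℝ → ℝ} (hJ : Integrable J) (hJm : Measurable J) {s : ℝ}
    (hs : 0 < s) : Integrable (heatMultiplier J s) := by
  have := (WithLp.volume_preserving_ofLp (Rn 3) ℝ).integrable_comp_of_integrable
    (integrable_heatMultiplier_prod hJ hJm hs)
  exact this

lemma norm_fourier_heatMultiplier_le {J : ℝ → ℝ} (hJ : Integrable J) (hJm : Measurable J) {s : ℝ}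
    (hs : 0 < s) (z : SpaceTime) :
    ‖𝓕 (fun v => (heatMultiplier J s v : ℂ)) z‖ ≤
      Real.pi * (∫ τ, ‖J τ‖) * heatSchrodinger ‖z.ofLp.1‖ z.ofLp.2 s := by
  obtain ⟨⟨x, t⟩, rfl⟩ : ∃ p, WithLp.toLp 2 p = z := ⟨z.ofLp, rfl⟩
  set b : ℂ := Real.pi * (s + 2 * t * I) with hb
  have hbre : b.re = Real.pi * s := by simp [hb]
  set Jhat : ℂ := ∫ τ : ℝ, cexp (↑(-2 * Real.pi * (τ * t)) * I) * (J τ : ℂ) with hJhat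
  have key : 𝓕 (fun v => (heatMultiplier J s v : ℂ)) (WithLp.toLp 2 (x, t)) =
      Real.pi * Jhat * 𝓕 (fun ξ : Rn 3 => cexp (-b * ‖ξ‖ ^ 2)) x := by
    have hint := (integrable_heatMultiplier_prod hJ hJm hs).ofReal (𝕜 := ℂ)
    calc 𝓕 (fun v => (heatMultiplier J s v : ℂ)) (WithLp.toLp 2 (x, t))
        = ∫ p : Rn 3 × ℝ, cexp (↑(-2 * Real.pi * (⟪p.1, x⟫ + p.2 * t)) * I) *
            (heatMultiplier J s (WithLp.toLp 2 p) : ℂ) := by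
          rw [Real.fourier_eq', ← (WithLp.volume_preserving_toLp (Rn 3) ℝ).integral_comp
            (MeasurableEquiv.toLp 2 (Rn 3 × ℝ)).measurableEmbedding]
          refine integral_congr_ae (.of_forall fun p => ?_)
          simp [WithLp.prod_inner_apply, mul_comm]
      _ = ∫ ξ : Rn 3, ∫ τ : ℝ, cexp (↑(-2 * Real.pi * (⟪ξ, x⟫ + τ * t)) * I) *
            (heatMultiplier J s (WithLp.toLp 2 (ξ, τ)) : ℂ) := by
          rw [Measure.volume_eq_prod, integral_prod]
          refine (hint.bdd_mul (c := 1) ?_ (.of_forall fun p => ?_))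
          · exact Continuous.aestronglyMeasurable (by fun_prop)
          · rw [Complex.norm_exp_ofReal_mul_I]
      _ = ∫ ξ : Rn 3, Real.pi * Jhat *
            (cexp (↑(-2 * Real.pi * ⟪ξ, x⟫) * I) * cexp (-b * ‖ξ‖ ^ 2)) := by
          refine integral_congr_ae (.of_forall fun ξ => ?_)
          dsimp only
          refine (integral_add_right_eq_self (fun τ : ℝ =>
            cexp (↑(-2 * Real.pi * (⟪ξ, x⟫ + τ * t)) * I) *
              (heatMultiplier J s (WithLp.toLp 2 (ξ, τ)) : ℂ)) (‖ξ‖ ^ 2)).symm.trans ?_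
          rw [hJhat, mul_assoc, mul_comm Jhat, ← mul_assoc, ← integral_const_mul]
          refine integral_congr_ae (.of_forall fun τ => ?_)
          simp only [heatMultiplier, add_sub_cancel_right]
          push_cast
          have : cexp (-2 * Real.pi * (⟪ξ, x⟫ + (τ + ‖ξ‖ ^ 2) * t) * I) *
              cexp (-(Real.pi * s * ‖ξ‖ ^ 2)) =
              cexp (-2 * Real.pi * ⟪ξ, x⟫ * I) * cexp (-b * ‖ξ‖ ^ 2) *
              cexp (-2 * Real.pi * (τ * t) * I) := by
            rw [← Complex.exp_add, ← Complex.exp_add, ← Complex.exp_add, hb]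
            congr 1
            ring
          linear_combination (Real.pi * J τ : ℂ) * this
      _ = _ := by
          rw [integral_const_mul, Real.fourier_eq']
          simp
  have hJle : ‖Jhat‖ ≤ ∫ τ, ‖J τ‖ := by
    refine (norm_integral_le_integral_norm _).trans_eq (integral_congr_ae (.of_forall fun τ => ?_))
    dsimp only
    rw [norm_mul, Complex.norm_exp_ofReal_mul_I, one_mul, Complex.norm_real]
  have hq : 0 < s ^ 2 + 4 * t ^ 2 := by positivity
  have hgauss : ‖𝓕 (fun ξ : Rn 3 => cexp (-b * ‖ξ‖ ^ 2)) x‖ = heatSchrodinger ‖x‖ t s := by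
    rw [fourier_gaussian_innerProductSpace (by rw [hbre]; positivity), norm_mul]
    have hns : Complex.normSq (s + 2 * t * I) = s ^ 2 + 4 * t ^ 2 := by
      simp [Complex.normSq_apply]; ring
    have hne : (s + 2 * t * I : ℂ) ≠ 0 := by
      rw [← Complex.normSq_pos, hns]; exact hq
    have hpi : (Real.pi : ℂ) ≠ 0 := by exact_mod_cast Real.pi_ne_zero
    have hdiv : (Real.pi / b : ℂ) = (s + 2 * t * I)⁻¹ := by
      rw [hb]; field_simp
    unfold heatSchrodinger
    congr 1
    · have : ((Module.finrank ℝ (Rn 3) : ℂ) / 2) = ((3 / 2 : ℝ) : ℂ) := by simp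
      rw [this, Complex.norm_cpow_real, hdiv, norm_inv, Complex.norm_def, hns, Real.sqrt_eq_rpow,
        ← Real.rpow_neg hq.le, ← Real.rpow_mul hq.le]
      norm_num
    · rw [Complex.norm_exp]
      congr 1
      have : (-(Real.pi : ℂ) ^ 2 * ‖x‖ ^ 2 / b) =
          ((-(Real.pi * ‖x‖ ^ 2) : ℝ) : ℂ) * (Real.pi / b) := by
        push_cast; ring
      rw [this, hdiv, Complex.re_ofReal_mul, Complex.inv_re, hns]
      simp
      ring
  rw [key, norm_mul, norm_mul, hgauss, Complex.norm_real, Real.norm_of_nonneg Real.pi_pos.le]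
  have : 0 ≤ heatSchrodinger ‖x‖ t s := by unfold heatSchrodinger; positivity
  gcongr

lemma lintegral_lintegral_lintegral_comm {α β γ : Type*} [MeasurableSpace α] [MeasurableSpace β]
    [MeasurableSpace γ] {μ : Measure α} {ν : Measure β} {ρ : Measure γ} [SFinite μ] [SFinite ν]
    [SFinite ρ] {F : α → β → γ → ℝ≥0∞} (hF : Measurable fun p : (α × β) × γ => F p.1.1 p.1.2 p.2) :
    ∫⁻ c, ∫⁻ a, ∫⁻ b, F a b c ∂ν ∂μ ∂ρ = ∫⁻ a, ∫⁻ b, ∫⁻ c, F a b c ∂ρ ∂ν ∂μ := by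
  have h1 : Measurable fun p : (γ × α) × β => F p.1.2 p.2 p.1.1 :=
    hF.comp (f := fun p : (γ × α) × β => ((p.1.2, p.2), p.1.1)) (by fun_prop)
  rw [lintegral_lintegral_swap h1.lintegral_prod_right'.aemeasurable]
  refine lintegral_congr fun a => lintegral_lintegral_swap ?_
  exact (hF.comp (f := fun p : γ × β => ((a, p.2), p.1)) (by fun_prop)).aemeasurable

lemma lintegral_pi_mul_exp_neg_sq (r : ℝ) :
    ∫⁻ s in Ioi (0 : ℝ), ENNReal.ofReal (Real.pi * Real.exp (-(Real.pi * s * r ^ 2))) =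
      (ENNReal.ofReal (r ^ 2))⁻¹ := by
  rcases eq_or_ne r 0 with rfl | hr
  · simp [Real.pi_pos]
  · have hc : 0 < Real.pi * r ^ 2 := by positivity
    have e : ∀ s : ℝ, Real.pi * Real.exp (-(Real.pi * s * r ^ 2)) =
        Real.pi * Real.exp (-(Real.pi * r ^ 2) * s) := fun s => by
      congr 2; ring
    simp_rw [e]
    have hi : IntegrableOn (fun s => Real.exp (-(Real.pi * r ^ 2) * s)) (Ioi 0) :=
      exp_neg_integrableOn_Ioi 0 hc
    rw [← ofReal_integral_eq_lintegral_ofReal (hi.const_mul _)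
      (.of_forall fun s => by positivity), integral_const_mul,
      integral_exp_mul_Ioi (by linarith) 0, ← ENNReal.ofReal_inv_of_pos (by positivity)]
    congr 1
    have := Real.pi_ne_zero
    field_simp
    simp

lemma lintegral_heatMultiplier {J : ℝ → ℝ} (v : SpaceTime) :
    ∫⁻ s in Ioi (0 : ℝ), ENNReal.ofReal (heatMultiplier J s v) =
      (ENNReal.ofReal (‖v.ofLp.1‖ ^ 2))⁻¹ * ENNReal.ofReal (J (v.ofLp.2 - ‖v.ofLp.1‖ ^ 2)) := by
  rw [← lintegral_pi_mul_exp_neg_sq, ← lintegral_mul_const' _ _ ENNReal.ofReal_ne_top]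
  refine lintegral_congr fun s => ?_
  rw [heatMultiplier, ENNReal.ofReal_mul (by positivity)]

lemma lintegral_heatSchrodinger_le_inv_parabolicNorm (p : Rn 3 × ℝ) :
    ∫⁻ s in Ioi (0 : ℝ), ENNReal.ofReal (heatSchrodinger ‖p.1‖ p.2 s) ≤
      6 * (ENNReal.ofReal (parabolicNorm p))⁻¹ := by
  rcases le_or_gt (parabolicNorm p) 0 with h | h
  · simp [ENNReal.ofReal_of_nonpos h]
  · refine (lintegral_heatSchrodinger_le h).trans_eq ?_
    change ENNReal.ofReal (6 * (parabolicNorm p)⁻¹) = _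
    rw [ENNReal.ofReal_mul (by norm_num), ENNReal.ofReal_inv_of_pos h]
    simp

/-- The weight `|ξ|⁻² J(τ - |ξ|²)` defines a quadratic form on the Fourier side which is dominated
by the potential with kernel the inverse of the parabolic norm. -/
lemma lintegral_weight_fourier_le {J : ℝ → ℝ} (hJ : Integrable J) (hJm : Measurable J)
    (hJ0 : ∀ τ, 0 ≤ J τ) {G : SpaceTime → ℂ} (hG : Integrable G) (hGc : Continuous G) :
    ∫⁻ v : SpaceTime, (ENNReal.ofReal (‖v.ofLp.1‖ ^ 2))⁻¹ *
        ENNReal.ofReal (J (v.ofLp.2 - ‖v.ofLp.1‖ ^ 2)) * ‖𝓕 G v‖ₑ ^ 2 ≤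
      ENNReal.ofReal (Real.pi * ∫ τ, ‖J τ‖) * 6 * ∫⁻ z : SpaceTime, ∫⁻ w : SpaceTime,
        ‖G z‖ₑ * (‖G w‖ₑ * (ENNReal.ofReal (parabolicNorm (w - z).ofLp))⁻¹) := by
  have hcont : Continuous (𝓕 G) :=
    VectorFourier.fourierIntegral_continuous Real.continuous_fourierChar
      (L := innerₗ SpaceTime) continuous_inner hG
  have hm : Measurable fun p : SpaceTime × ℝ => ENNReal.ofReal (heatMultiplier J p.2 p.1) := by
    unfold heatMultiplier
    fun_prop
  have hmG : Measurable fun p : SpaceTime × ℝ =>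
      ENNReal.ofReal (heatMultiplier J p.2 p.1) * ‖𝓕 G p.1‖ₑ ^ 2 :=
    hm.mul ((hcont.enorm.measurable.comp measurable_fst).pow_const 2)
  have hh : Measurable fun p : (SpaceTime × SpaceTime) × ℝ => ENNReal.ofReal
      (heatSchrodinger ‖(p.1.2 - p.1.1).ofLp.1‖ (p.1.2 - p.1.1).ofLp.2 p.2) := by
    unfold heatSchrodinger
    fun_prop
  have hGm : Measurable fun z => ‖G z‖ₑ := hGc.enorm.measurable
  set c := ENNReal.ofReal (Real.pi * ∫ τ, ‖J τ‖)
  have hc : c * 6 ≠ ⊤ := ENNReal.mul_ne_top ENNReal.ofReal_ne_top (by simp)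
  have hker : ∀ s ∈ Ioi (0 : ℝ), ∀ z : SpaceTime,
      ‖𝓕 (fun v => (heatMultiplier J s v : ℂ)) z‖ₑ ≤
        c * ENNReal.ofReal (heatSchrodinger ‖z.ofLp.1‖ z.ofLp.2 s) := fun s hs z => by
    rw [← ENNReal.ofReal_mul (by positivity), ← ofReal_norm]
    exact ENNReal.ofReal_le_ofReal (norm_fourier_heatMultiplier_le hJ hJm hs z)
  calc _ = ∫⁻ v, ∫⁻ s in Ioi (0 : ℝ), ENNReal.ofReal (heatMultiplier J s v) * ‖𝓕 G v‖ₑ ^ 2 := by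
        refine lintegral_congr fun v => ?_
        rw [← lintegral_heatMultiplier, lintegral_mul_const' _ _ (by simp)]
    _ = ∫⁻ s in Ioi (0 : ℝ), ∫⁻ v, ENNReal.ofReal (heatMultiplier J s v) * ‖𝓕 G v‖ₑ ^ 2 :=
        lintegral_lintegral_swap hmG.aemeasurable
    _ ≤ ∫⁻ s in Ioi (0 : ℝ), ∫⁻ z, ∫⁻ w, ‖G z‖ₑ * (‖G w‖ₑ * (c * ENNReal.ofReal
          (heatSchrodinger ‖(w - z).ofLp.1‖ (w - z).ofLp.2 s))) := by
        refine setLIntegral_mono' measurableSet_Ioi fun s hs => ?_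
        refine (lintegral_multiplier_le (integrable_heatMultiplier hJ hJm hs)
          (fun v => mul_nonneg (by positivity) (hJ0 _)) hG).trans ?_
        gcongr with z w
        exact hker s hs _
    _ = ∫⁻ z, ∫⁻ w, ‖G z‖ₑ * (‖G w‖ₑ * (c * ∫⁻ s in Ioi (0 : ℝ), ENNReal.ofReal
          (heatSchrodinger ‖(w - z).ofLp.1‖ (w - z).ofLp.2 s))) := by
        rw [lintegral_lintegral_lintegral_comm]
        · refine lintegral_congr fun z => lintegral_congr fun w => ?_
          rw [lintegral_const_mul' _ _ enorm_ne_top, lintegral_const_mul' _ _ enorm_ne_top,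
            lintegral_const_mul' _ _ ENNReal.ofReal_ne_top]
        · exact (hGm.comp (measurable_fst.comp measurable_fst)).mul
            ((hGm.comp (measurable_snd.comp measurable_fst)).mul (measurable_const.mul hh))
    _ ≤ ∫⁻ z, ∫⁻ w, ‖G z‖ₑ * (‖G w‖ₑ * (c * (6 *
          (ENNReal.ofReal (parabolicNorm (w - z).ofLp))⁻¹))) := by
        gcongr with z w
        exact lintegral_heatSchrodinger_le_inv_parabolicNorm _
    _ = _ := by
        rw [← lintegral_const_mul' _ _ hc]
        refine lintegral_congr fun z => ?_
        rw [← lintegral_const_mul' _ _ hc]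
        refine lintegral_congr fun w => ?_
        ring

lemma exists_lintegral_parabolic_potential_le :
    ∃ C : ℝ≥0∞, C ≠ ⊤ ∧ ∀ {h : SpaceTime → ℝ≥0∞}, Measurable h → (∀ z, h z ≠ ⊤) →
      ∫⁻ z, h z ^ (10 : ℝ) ≠ 0 → ∫⁻ z, h z ^ (10 : ℝ) ≠ ⊤ →
      ∫⁻ z, ∫⁻ w, h z ^ (9 : ℝ) *
          (h w ^ (9 : ℝ) * (ENNReal.ofReal (parabolicNorm (w - z).ofLp))⁻¹) ≤
        C * (∫⁻ z, h z ^ (10 : ℝ)) ^ (9 / 5 : ℝ) := by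
  obtain ⟨A, hA, hsplit⟩ := parabolic_kernel_split
  refine ⟨2 * (A + A ^ (1 / 10 : ℝ)), ?_, fun {h} hh hht hN0 hNt => ?_⟩
  · exact ENNReal.mul_ne_top (by simp) (ENNReal.add_ne_top.2
      ⟨hA, ENNReal.rpow_ne_top_of_nonneg (by norm_num) hA⟩)
  have hmeas : Measurable fun p : SpaceTime × SpaceTime => parabolicNorm (p.2 - p.1).ofLp :=
    measurable_parabolicNorm.comp (by fun_prop)
  have hls := lintegral_lintegral_hls (A := A) (μ := (volume : Measure SpaceTime))
    (κ := fun z w => (ENNReal.ofReal (parabolicNorm (w - z).ofLp))⁻¹) (h := h)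
  rw [mul_assoc 2]
  refine hls ?_ ?_ ?_ hh hht hN0 hNt
  · exact (ENNReal.measurable_ofReal.comp hmeas).inv
  · intro z w
    simp only [parabolicNorm, WithLp.ofLp_sub, Prod.fst_sub, Prod.snd_sub]
    rw [norm_sub_rev, abs_sub_comm]
  · intro z R hR
    have hS : MeasurableSet {p | parabolicNorm p < R} :=
      measurableSet_lt measurable_parabolicNorm measurable_const
    have hmp : MeasurePreserving (fun w : SpaceTime => (w - z).ofLp) volume volume :=
      (WithLp.volume_preserving_ofLp (Rn 3) ℝ).comp (measurePreserving_sub_right volume z)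
    have hk : Measurable fun p => (ENNReal.ofReal (parabolicNorm p))⁻¹ :=
      (ENNReal.measurable_ofReal.comp measurable_parabolicNorm).inv
    refine ⟨(fun w : SpaceTime => (w - z).ofLp) ⁻¹' {p | parabolicNorm p < R},
      hmp.measurable hS, ?_, ?_⟩
    · rw [hmp.setLIntegral_comp_preimage hS hk]
      exact (hsplit R hR).1
    · rw [← preimage_compl, hmp.setLIntegral_comp_preimage hS.compl (hk.pow_const _)]
      exact (hsplit R hR).2

lemma SchwartzMap.exists_eq_mul_norm_pow {V : Type*} [NormedAddCommGroup V] [NormedSpace ℝ V]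
    (f : SchwartzMap V ℂ) (k : ℕ) :
    ∃ g : SchwartzMap V ℂ, ∀ x, g x = ((‖f x‖ ^ 2) ^ k : ℝ) * f x := by
  have h : Function.HasTemperateGrowth fun x => (‖f x‖ ^ 2) ^ k :=
    ((Function.hasTemperateGrowth_norm_sq ℂ).comp f.hasTemperateGrowth).pow k
  exact ⟨SchwartzMap.smulLeftCLM ℂ (fun x => (‖f x‖ ^ 2) ^ k) f, fun x => by
    rw [SchwartzMap.smulLeftCLM_apply_apply h, Complex.real_smul]⟩

lemma ae_fst_ne_zero : ∀ᵐ v : SpaceTime, v.ofLp.1 ≠ 0 := by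
  have h : Measure.QuasiMeasurePreserving (fun v : SpaceTime => v.ofLp.1) volume volume :=
    Measure.quasiMeasurePreserving_fst.comp
      (WithLp.volume_preserving_ofLp (Rn 3) ℝ).quasiMeasurePreserving
  exact h.ae (p := fun x => x ≠ 0) (compl_mem_ae_iff.2 (measure_singleton 0))

lemma lintegral_mul_le_weighted {α : Type*} [MeasurableSpace α] {μ : Measure α}
    {W f g : α → ℝ≥0∞} (hW : Measurable W) (hf : Measurable f) (hg : Measurable g)
    (hW0 : ∀ᵐ x ∂μ, W x ≠ 0) (hWt : ∀ᵐ x ∂μ, W x ≠ ⊤) :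
    ∫⁻ x, f x * g x ∂μ ≤
      (∫⁻ x, W x * f x ^ 2 ∂μ) ^ (1 / 2 : ℝ) * (∫⁻ x, (W x)⁻¹ * g x ^ 2 ∂μ) ^ (1 / 2 : ℝ) := by
  have h := ENNReal.lintegral_mul_le_Lp_mul_Lq μ Real.HolderConjugate.two_two
    (f := fun x => W x ^ (1 / 2 : ℝ) * f x) (g := fun x => (W x)⁻¹ ^ (1 / 2 : ℝ) * g x)
    ((hW.pow_const _).mul hf).aemeasurable ((hW.inv.pow_const _).mul hg).aemeasurable
  have e : ∀ a b : ℝ≥0∞, (a ^ (1 / 2 : ℝ) * b) ^ (2 : ℝ) = a * b ^ 2 := fun a b => by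
    rw [ENNReal.mul_rpow_of_nonneg _ _ (by norm_num), ← ENNReal.rpow_mul]
    norm_num
  simp_rw [e] at h
  refine le_trans (le_of_eq (lintegral_congr_ae ?_)) h
  filter_upwards [hW0, hWt] with x h0 ht
  simp only [Pi.mul_apply]
  rw [mul_mul_mul_comm, ← ENNReal.mul_rpow_of_nonneg _ _ (by norm_num),
    ENNReal.mul_inv_cancel h0 ht, ENNReal.one_rpow, one_mul]

lemma SchwartzMap.lintegral_enorm_rpow_ten_ne_top (f : SchwartzMap SpaceTime ℂ) :
    ∫⁻ z, ‖f z‖ₑ ^ (10 : ℝ) ≠ ⊤ := by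
  have h := (f.memLp 10).eLpNorm_lt_top
  exact (lintegral_rpow_enorm_lt_top_of_eLpNorm_lt_top (by simp) (by simp) h).ne

/-- The `L^{10}` estimate with a general integrable profile `J` in the modulation variable. -/
lemma exists_enorm_ten_le_weighted {J : ℝ → ℝ} (hJ : Integrable J) (hJm : Measurable J)
    (hJ0 : ∀ τ, 0 < J τ) :
    ∃ C : ℝ≥0∞, C ≠ ⊤ ∧ ∀ f : SchwartzMap SpaceTime ℂ,
      (∫⁻ z, ‖f z‖ₑ ^ (10 : ℝ)) ^ (1 / 10 : ℝ) ≤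
        C * (∫⁻ v : SpaceTime, ENNReal.ofReal (‖v.ofLp.1‖ ^ 2) *
          (ENNReal.ofReal (J (v.ofLp.2 - ‖v.ofLp.1‖ ^ 2)))⁻¹ * ‖𝓕 f v‖ₑ ^ 2) ^ (1 / 2 : ℝ) := by
  obtain ⟨A, hA, hpot⟩ := exists_lintegral_parabolic_potential_le
  set c := ENNReal.ofReal (Real.pi * ∫ τ, ‖J τ‖) * 6 with hc
  have hct : c ≠ ⊤ := ENNReal.mul_ne_top ENNReal.ofReal_ne_top (by simp)
  refine ⟨(c * A) ^ (1 / 2 : ℝ), ENNReal.rpow_ne_top_of_nonneg (by norm_num)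
    (ENNReal.mul_ne_top hct hA), fun f => ?_⟩
  set N := ∫⁻ z, ‖f z‖ₑ ^ (10 : ℝ) with hN
  have hNt : N ≠ ⊤ := f.lintegral_enorm_rpow_ten_ne_top
  rcases eq_or_ne N 0 with hN0 | hN0
  · simp [hN0]
  obtain ⟨g, hg⟩ := f.exists_eq_mul_norm_pow 4
  have hgn : ∀ z, ‖g z‖ₑ = ‖f z‖ₑ ^ (9 : ℝ) := fun z => by
    rw [hg, ← ofReal_norm, ← ofReal_norm, norm_mul, Complex.norm_real,
      Real.norm_of_nonneg (by positivity), ← pow_mul, ← pow_succ,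
      ENNReal.ofReal_rpow_of_nonneg (norm_nonneg _) (by norm_num)]
    congr 1
    rw [← Real.rpow_natCast]
    norm_num
  set W : SpaceTime → ℝ≥0∞ := fun v => ENNReal.ofReal (‖v.ofLp.1‖ ^ 2) *
    (ENNReal.ofReal (J (v.ofLp.2 - ‖v.ofLp.1‖ ^ 2)))⁻¹ with hW
  have hWm : Measurable W := by
    rw [hW]
    fun_prop
  have hJpos : ∀ τ, ENNReal.ofReal (J τ) ≠ 0 := fun τ => by simpa using hJ0 τ
  have hW0 : ∀ᵐ v, W v ≠ 0 := by
    filter_upwards [ae_fst_ne_zero] with v hv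
    exact mul_ne_zero (by simpa using hv) (by simp)
  have hWt : ∀ v, W v ≠ ⊤ := fun v =>
    ENNReal.mul_ne_top ENNReal.ofReal_ne_top (ENNReal.inv_ne_top.2 (hJpos _))
  have hNle : N ≤ ∫⁻ v, ‖𝓕 f v‖ₑ * ‖𝓕 g v‖ₑ := by
    have h1 : ∀ z, inner ℂ (g z) (f z) = ((‖f z‖ ^ 10 : ℝ) : ℂ) := fun z => by
      rw [RCLike.inner_apply, hg, map_mul, Complex.conj_ofReal, mul_left_comm, Complex.mul_conj,
        Complex.normSq_eq_norm_sq]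
      push_cast
      ring
    have h2 := SchwartzMap.integral_inner_fourier_fourier g f
    have h3 : ENNReal.ofReal (∫ z, ‖f z‖ ^ 10) = N := by
      rw [ofReal_integral_eq_lintegral_ofReal]
      · refine lintegral_congr fun z => ?_
        rw [ENNReal.ofReal_pow (norm_nonneg _), ofReal_norm]
        norm_cast
      · refine ⟨(f.continuous.norm.pow 10).aestronglyMeasurable, ?_⟩
        refine lt_of_eq_of_lt (lintegral_congr fun z => ?_) hNt.lt_top
        rw [enorm_pow, enorm_norm]
        norm_cast
      · exact .of_forall fun z => by positivity
    simp_rw [h1] at h2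
    rw [integral_complex_ofReal] at h2
    calc N = ‖((∫ z, ‖f z‖ ^ 10 : ℝ) : ℂ)‖ₑ := by
          rw [← h3, ← ofReal_norm, Complex.norm_real, Real.norm_of_nonneg]
          exact integral_nonneg fun z => by positivity
      _ ≤ ∫⁻ v, ‖inner ℂ (𝓕 g v) (𝓕 f v)‖ₑ := by
          rw [← h2]
          exact enorm_integral_le_lintegral_enorm _
      _ = _ := by
          refine lintegral_congr fun v => ?_
          rw [RCLike.inner_apply, enorm_mul, RCLike.enorm_conj]
  have hWinv : ∀ v, (W v)⁻¹ = (ENNReal.ofReal (‖v.ofLp.1‖ ^ 2))⁻¹ *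
      ENNReal.ofReal (J (v.ofLp.2 - ‖v.ofLp.1‖ ^ 2)) := fun v => by
    rw [hW, ENNReal.mul_inv (.inr (ENNReal.inv_ne_top.2 (hJpos _))) (.inl ENNReal.ofReal_ne_top),
      inv_inv]
  have hdual : ∫⁻ v, (W v)⁻¹ * ‖𝓕 g v‖ₑ ^ 2 ≤ c * A * N ^ (9 / 5 : ℝ) := by
    refine (lintegral_congr fun v => by rw [hWinv]).trans_le ?_
    refine (lintegral_weight_fourier_le hJ hJm (fun τ => (hJ0 τ).le) g.integrable
      g.continuous).trans ?_
    rw [mul_assoc c]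
    gcongr
    simp_rw [hgn]
    exact hpot f.continuous.enorm.measurable (fun z => enorm_ne_top) hN0 hNt
  have hmain : N ^ (9 / 10 : ℝ) * N ^ (1 / 10 : ℝ) ≤ N ^ (9 / 10 : ℝ) *
      ((c * A) ^ (1 / 2 : ℝ) * (∫⁻ v, W v * ‖𝓕 f v‖ₑ ^ 2) ^ (1 / 2 : ℝ)) := by
    calc N ^ (9 / 10 : ℝ) * N ^ (1 / 10 : ℝ) = N := by
          rw [← ENNReal.rpow_add _ _ hN0 hNt]
          norm_num
      _ ≤ (∫⁻ v, W v * ‖𝓕 f v‖ₑ ^ 2) ^ (1 / 2 : ℝ) *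
            (∫⁻ v, (W v)⁻¹ * ‖𝓕 g v‖ₑ ^ 2) ^ (1 / 2 : ℝ) :=
          hNle.trans (lintegral_mul_le_weighted hWm (𝓕 f).continuous.enorm.measurable
            (𝓕 g).continuous.enorm.measurable hW0 (.of_forall hWt))
      _ ≤ (∫⁻ v, W v * ‖𝓕 f v‖ₑ ^ 2) ^ (1 / 2 : ℝ) * (c * A * N ^ (9 / 5 : ℝ)) ^ (1 / 2 : ℝ) := by
          gcongr
      _ = _ := by
          rw [ENNReal.mul_rpow_of_nonneg _ _ (by norm_num), ← ENNReal.rpow_mul]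
          norm_num
          ring
  exact (ENNReal.mul_le_mul_iff_right (by simp [hN0, hNt]) (by simp [hN0, hNt])).1 hmain

lemma japR_pos (x : ℝ) : 0 < japR x := Real.sqrt_pos.2 (by positivity)

lemma japR_rpow_two_mul (x b : ℝ) : japR x ^ (2 * b) = (1 + ‖x‖ ^ 2) ^ b := by
  rw [japR, Real.sqrt_eq_rpow, ← Real.rpow_mul (by positivity), Real.norm_eq_abs, sq_abs]
  congr 1
  ring

lemma integrable_japR_rpow_inv {b : ℝ} (hb : 1 / 2 < b) :
    Integrable fun x : ℝ => (japR x ^ (2 * b))⁻¹ := by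
  have h := integrable_rpow_neg_one_add_norm_sq (E := ℝ) (μ := volume) (r := 2 * b)
    (by simp; linarith)
  refine h.congr (.of_forall fun x => ?_)
  dsimp only
  rw [japR_rpow_two_mul, ← Real.rpow_neg (by positivity)]
  congr 1
  ring

lemma hasTemperateGrowth_fst :
    Function.HasTemperateGrowth fun v : SpaceTime => v.ofLp.1 :=
  ((ContinuousLinearMap.fst ℝ (Rn 3) ℝ).comp
    (WithLp.prodContinuousLinearEquiv 2 ℝ (Rn 3) ℝ).toContinuousLinearMap).hasTemperateGrowth

lemma hasTemperateGrowth_snd :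
    Function.HasTemperateGrowth fun v : SpaceTime => v.ofLp.2 :=
  ((ContinuousLinearMap.snd ℝ (Rn 3) ℝ).comp
    (WithLp.prodContinuousLinearEquiv 2 ℝ (Rn 3) ℝ).toContinuousLinearMap).hasTemperateGrowth

lemma hasTemperateGrowth_japR_rpow (b : ℝ) : Function.HasTemperateGrowth fun v : SpaceTime =>
    japR (v.ofLp.2 - ‖v.ofLp.1‖ ^ 2) ^ (2 * b) := by
  simp_rw [japR_rpow_two_mul]
  exact (Function.hasTemperateGrowth_one_add_norm_sq_rpow ℝ b).comp
    (hasTemperateGrowth_snd.sub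
      ((Function.hasTemperateGrowth_norm_sq (Rn 3)).comp hasTemperateGrowth_fst))

/-- Weighted `L²` densities of Schwartz functions are integrable. -/
lemma SchwartzMap.integrable_weight_mul_norm_sq {V : Type*} [NormedAddCommGroup V]
    [NormedSpace ℝ V] [FiniteDimensional ℝ V] [MeasureSpace V] [BorelSpace V]
    [(volume : Measure V).HasTemperateGrowth]
    {k : V → ℝ} (hk : k.HasTemperateGrowth) (f : SchwartzMap V ℂ) :
    Integrable fun v => k v * ‖f v‖ ^ 2 := by
  have h := ((SchwartzMap.smulLeftCLM ℂ k f).memLp 2).norm.integrable_mul (f.memLp 2).norm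
  refine h.mono (by
    have := hk.1.continuous
    have := f.continuous
    exact (by fun_prop : Continuous _).aestronglyMeasurable) (.of_forall fun v => ?_)
  simp only [Pi.mul_apply, SchwartzMap.smulLeftCLM_apply_apply hk, norm_smul, norm_mul, norm_pow,
    norm_norm]
  exact le_of_eq (by ring)

lemma stFourier_eq_fourier {E : Type*} [NormedAddCommGroup E] [NormedSpace ℂ E]
    {F : SpaceTime → E} (hF : Integrable F) (ξ : Rn 3) (τ : ℝ) :
    stFourier 3 (fun x t => F (WithLp.toLp 2 (x, t))) ξ τ = 𝓕 F (WithLp.toLp 2 (ξ, τ)) := by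
  have hF' : Integrable fun p : Rn 3 × ℝ => F (WithLp.toLp 2 p) :=
    (WithLp.volume_preserving_toLp (Rn 3) ℝ).integrable_comp_of_integrable hF
  rw [Real.fourier_eq', ← (WithLp.volume_preserving_toLp (Rn 3) ℝ).integral_comp
    (MeasurableEquiv.toLp 2 (Rn 3 × ℝ)).measurableEmbedding, Measure.volume_eq_prod, integral_prod]
  · unfold stFourier
    refine integral_congr_ae (.of_forall fun x => integral_congr_ae (.of_forall fun t => ?_))
    simp [WithLp.prod_inner_apply, mul_comm]
  · refine hF'.bdd_smul (C := 1) ?_ (.of_forall fun p => ?_)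
    · exact Continuous.aestronglyMeasurable (by fun_prop)
    · rw [Complex.norm_exp_ofReal_mul_I]

/-- A Schwartz function on `ℝ³ × ℝ` regarded as one on Euclidean space-time. -/
def toSpaceTime (φ : SchwartzMap (Rn 3 × ℝ) ℂ) : SchwartzMap SpaceTime ℂ :=
  SchwartzMap.compCLMOfContinuousLinearEquiv ℂ (WithLp.prodContinuousLinearEquiv 2 ℝ (Rn 3) ℝ) φ

lemma toSpaceTime_apply (φ : SchwartzMap (Rn 3 × ℝ) ℂ) (v : SpaceTime) :
    toSpaceTime φ v = φ v.ofLp := rfl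

/-- The unit vector in the `i`-th spatial direction of space-time. -/
def spaceDir (i : Fin 3) : SpaceTime := WithLp.toLp 2 (EuclideanSpace.single i 1, 0)

open LineDeriv in
lemma gradC_apply_eq_lineDerivOp (φ : SchwartzMap (Rn 3 × ℝ) ℂ) (x : Rn 3) (t : ℝ) (i : Fin 3) :
    gradC (fun y => φ (y, t)) x i = ∂_{spaceDir i} (toSpaceTime φ) (WithLp.toLp 2 (x, t)) := by
  have hd : DifferentiableAt ℝ (fun y : Rn 3 => φ (y, t)) x :=
    (φ.differentiable.comp (by fun_prop : Differentiable ℝ fun y : Rn 3 => (y, t))) x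
  rw [SchwartzMap.lineDerivOp_apply]
  change fderiv ℝ (fun y => φ (y, t)) x (EuclideanSpace.single i 1) = _
  rw [← hd.lineDeriv_eq_fderiv]
  simp [lineDeriv, toSpaceTime_apply, spaceDir]

lemma fourier_lineDerivOp_spaceDir (f : SchwartzMap SpaceTime ℂ) (v : SpaceTime) (i : Fin 3) :
    𝓕 (LineDeriv.lineDerivOp (spaceDir i) f) v = 2 * Real.pi * I * (v.ofLp.1 i * 𝓕 f v) := by
  have h : Function.HasTemperateGrowth fun w : SpaceTime => ⟪w, spaceDir i⟫ :=
    ((innerSL ℝ).flip (spaceDir i)).hasTemperateGrowth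
  rw [SchwartzMap.fourier_lineDerivOp_eq, smul_apply,
    SchwartzMap.smulLeftCLM_apply_apply h]
  simp [spaceDir, WithLp.prod_inner_apply, EuclideanSpace.inner_single_right]

lemma norm_sq_stFourier_gradC (φ : SchwartzMap (Rn 3 × ℝ) ℂ) (ξ : Rn 3) (τ : ℝ) :
    ‖stFourier 3 (fun x t => gradC (fun y => φ (y, t)) x) ξ τ‖ ^ 2 =
      4 * Real.pi ^ 2 * (‖ξ‖ ^ 2 * ‖𝓕 (toSpaceTime φ) (WithLp.toLp 2 (ξ, τ))‖ ^ 2) := by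
  set F : SpaceTime → EuclideanSpace ℂ (Fin 3) :=
    fun v => gradC (fun y => φ (y, v.ofLp.2)) v.ofLp.1 with hF
  have hcomp : ∀ i, (fun v => F v i) = LineDeriv.lineDerivOp (spaceDir i) (toSpaceTime φ) :=
    fun i => funext fun v => gradC_apply_eq_lineDerivOp φ v.ofLp.1 v.ofLp.2 i
  have hFi : Integrable F := Integrable.of_eval_piLp fun i => by
    rw [hcomp]
    exact SchwartzMap.integrable _
  have hfour : ∀ v i, 𝓕 F v i = 2 * Real.pi * I * (v.ofLp.1 i * 𝓕 (toSpaceTime φ) v) := by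
    intro v i
    rw [← fourier_lineDerivOp_spaceDir, SchwartzMap.fourier_coe, ← hcomp, Real.fourier_eq,
      Real.fourier_eq, eval_integral_piLp]
    · rfl
    · intro i
      exact ((Real.fourierIntegral_convergent_iff v).2 hFi).eval_piLp i
  change ‖stFourier 3 (fun x t => F (WithLp.toLp 2 (x, t))) ξ τ‖ ^ 2 = _
  rw [stFourier_eq_fourier hFi, EuclideanSpace.norm_sq_eq, EuclideanSpace.norm_sq_eq ξ,
    Finset.sum_mul, Finset.mul_sum]
  refine Finset.sum_congr rfl fun i _ => ?_
  rw [hfour]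
  rw [norm_mul, norm_mul, norm_mul, norm_mul, Complex.norm_I, Complex.norm_real, Complex.norm_real,
    Real.norm_of_nonneg Real.pi_pos.le, Complex.norm_two]
  ring

lemma ofReal_lpNormST_ten (φ : SchwartzMap (Rn 3 × ℝ) ℂ) :
    ENNReal.ofReal (lpNormST 3 10 (fun x t => φ (x, t))) =
      (∫⁻ z, ‖toSpaceTime φ z‖ₑ ^ (10 : ℝ)) ^ (1 / 10 : ℝ) := by
  have hm := WithLp.volume_preserving_toLp (Rn 3) ℝ
  have hlin : ∫⁻ z, ‖toSpaceTime φ z‖ₑ ^ (10 : ℝ) =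
      ∫⁻ p : Rn 3 × ℝ, ENNReal.ofReal (‖φ p‖ ^ (10 : ℝ)) := by
    rw [← hm.lintegral_comp ((toSpaceTime φ).continuous.enorm.measurable.pow_const _)]
    refine lintegral_congr fun p => ?_
    rw [← ENNReal.ofReal_rpow_of_nonneg (norm_nonneg _) (by norm_num), ofReal_norm]
    rfl
  have hmeas : AEStronglyMeasurable (fun p => ‖φ p‖ ^ (10 : ℝ)) :=
    (φ.continuous.norm.rpow_const fun _ => .inr (by norm_num)).aestronglyMeasurable
  have hnn : 0 ≤ᵐ[volume] fun p => ‖φ p‖ ^ (10 : ℝ) := .of_forall fun p => by positivity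
  have hint : Integrable fun p => ‖φ p‖ ^ (10 : ℝ) := by
    rw [← lintegral_ofReal_ne_top_iff_integrable hmeas hnn, ← hlin]
    exact (toSpaceTime φ).lintegral_enorm_rpow_ten_ne_top
  rw [hlin, ← ofReal_integral_eq_lintegral_ofReal hint hnn, lpNormST, Measure.volume_eq_prod,
    integral_prod_symm _ hint, ENNReal.ofReal_rpow_of_nonneg _ (by norm_num)]
  exact integral_nonneg fun t => integral_nonneg fun x => by positivity

lemma ofReal_XNorm_gradC (b : ℝ) (φ : SchwartzMap (Rn 3 × ℝ) ℂ) :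
    ENNReal.ofReal (XNorm 3 0 b (fun x t => gradC (fun y => φ (y, t)) x)) =
      (ENNReal.ofReal (4 * Real.pi ^ 2) * ∫⁻ v : SpaceTime, ENNReal.ofReal (‖v.ofLp.1‖ ^ 2) *
        (ENNReal.ofReal (japR (v.ofLp.2 - ‖v.ofLp.1‖ ^ 2) ^ (2 * b))⁻¹)⁻¹ *
          ‖𝓕 (toSpaceTime φ) v‖ₑ ^ 2) ^ (1 / 2 : ℝ) := by
  have hm := WithLp.volume_preserving_toLp (Rn 3) ℝ
  set k : SpaceTime → ℝ := fun v => ‖v.ofLp.1‖ ^ 2 *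
    japR (v.ofLp.2 - ‖v.ofLp.1‖ ^ 2) ^ (2 * b) with hk
  have hkt : k.HasTemperateGrowth :=
    ((Function.hasTemperateGrowth_norm_sq (Rn 3)).comp hasTemperateGrowth_fst).mul
      (hasTemperateGrowth_japR_rpow b)
  have hk0 : ∀ v, 0 ≤ k v := fun v =>
    mul_nonneg (by positivity) (Real.rpow_nonneg (japR_pos _).le _)
  have hint := SchwartzMap.integrable_weight_mul_norm_sq hkt (𝓕 (toSpaceTime φ))
  have hint' : Integrable fun p : Rn 3 × ℝ => 4 * Real.pi ^ 2 *
      (k (WithLp.toLp 2 p) * ‖𝓕 (toSpaceTime φ) (WithLp.toLp 2 p)‖ ^ 2) :=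
    (hm.integrable_comp_of_integrable hint).const_mul _
  have h1 : (∫ ξ : Rn 3, ∫ τ : ℝ, jap ξ ^ (2 * (0 : ℝ)) * japR (τ - ‖ξ‖ ^ 2) ^ (2 * b) *
      ‖stFourier 3 (fun x t => gradC (fun y => φ (y, t)) x) ξ τ‖ ^ 2) =
      4 * Real.pi ^ 2 * ∫ v, k v * ‖𝓕 (toSpaceTime φ) v‖ ^ 2 := by
    rw [← hm.integral_comp (MeasurableEquiv.toLp 2 (Rn 3 × ℝ)).measurableEmbedding,
      ← integral_const_mul, Measure.volume_eq_prod, integral_prod _ hint']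
    refine integral_congr_ae (.of_forall fun x => integral_congr_ae (.of_forall fun t => ?_))
    dsimp only
    rw [norm_sq_stFourier_gradC, hk]
    simp
    ring
  have hnn : ∀ v, 0 ≤ k v * ‖𝓕 (toSpaceTime φ) v‖ ^ 2 := fun v =>
    mul_nonneg (hk0 v) (by positivity)
  rw [XNorm, h1, ← ENNReal.ofReal_rpow_of_nonneg
    (mul_nonneg (by positivity) (integral_nonneg hnn)) (by norm_num),
    ENNReal.ofReal_mul (by positivity), ofReal_integral_eq_lintegral_ofReal hint (.of_forall hnn)]
  congr 2
  refine lintegral_congr fun v => ?_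
  rw [ENNReal.ofReal_mul (hk0 v), hk, ENNReal.ofReal_mul (by positivity),
    ENNReal.ofReal_inv_of_pos (Real.rpow_pos_of_pos (japR_pos _) _), inv_inv,
    ENNReal.ofReal_pow (norm_nonneg (𝓕 (toSpaceTime φ) v)), ofReal_norm]

/-- L^{10} space-time estimate in ℝ^{3+1}. -/
theorem statement_16 :
    ∃ ε₀ > (0:ℝ), ∀ ε : ℝ, 0 < ε → ε < ε₀ →
    ∃ C > (0:ℝ), ∀ φ : SchwartzMap (Rn 3 × ℝ) ℂ,
    lpNormST 3 10 (fun x t => φ (x, t))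
      ≤ C * XNorm 3 0 (1/2 + ε) (fun x t => gradC (fun y => φ (y, t)) x) := by
  refine ⟨1, one_pos, fun ε hε _ => ?_⟩
  have hpos : ∀ τ, 0 < (japR τ ^ (2 * (1 / 2 + ε)))⁻¹ := fun τ =>
    inv_pos.2 (Real.rpow_pos_of_pos (japR_pos τ) _)
  obtain ⟨C, hC, hmain⟩ := exists_enorm_ten_le_weighted
    (integrable_japR_rpow_inv (b := 1 / 2 + ε) (by linarith)) (by unfold japR; fun_prop) hpos
  refine ⟨C.toReal + 1, by positivity, fun φ => ?_⟩
  set X := XNorm 3 0 (1 / 2 + ε) (fun x t => gradC (fun y => φ (y, t)) x) with hX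
  have hX0 : 0 ≤ X := Real.rpow_nonneg (integral_nonneg fun ξ => integral_nonneg fun τ =>
    mul_nonneg (mul_nonneg (Real.rpow_nonneg (Real.sqrt_nonneg _) _)
      (Real.rpow_nonneg (japR_pos _).le _)) (by positivity)) _
  have h : ENNReal.ofReal (lpNormST 3 10 (fun x t => φ (x, t))) ≤ C * ENNReal.ofReal X := by
    rw [ofReal_lpNormST_ten, hX, ofReal_XNorm_gradC]
    refine (hmain (toSpaceTime φ)).trans ?_
    gcongr
    refine le_mul_of_one_le_left' ?_
    rw [ENNReal.one_le_ofReal]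
    nlinarith [Real.pi_gt_three]
  have h2 : lpNormST 3 10 (fun x t => φ (x, t)) ≤ C.toReal * X := by
    rw [← ENNReal.ofReal_toReal hC, ← ENNReal.ofReal_mul ENNReal.toReal_nonneg] at h
    exact (ENNReal.ofReal_le_ofReal_iff (by positivity)).1 h
  linarith

end
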